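/- For every measurable space 𝒳, every probability distribution D over 𝒳×{0,1}, and every measurable predictor f:𝒳→[0,1], it holds that ldCE_D(f) ≤ dCE_D(f) ≤ 4·√(ldCE_D(f)), and also (1/16)·udCE_D(f)² ≤ dCE_D(f) ≤ udCE_D(f). -/

import Mathlib

open MeasureTheory Set

noncomputable section

/-- The unit interval `[0,1]` as a type. -/
abbrev I01 : Type := unitInterval

/-- The real value of a Boolean label. -/
def lbl (y : Bool) : ℝ := if y then 1 else 0

/-- The calibration correlation `E_{(v,y)∼Γ}[(y − v)·w(v)]` against a weight function `w`. -/
def calErr (Γ : Measure (I01 × Bool)) (w : I01 → ℝ) : ℝ :=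
  ∫ p, (lbl p.2 - (p.1 : ℝ)) * w p.1 ∂Γ

/-- A prediction-label distribution `Γ` on `[0,1] × {0,1}` is perfectly calibrated iff
`E[(y − v)·w(v)] = 0` for every bounded measurable weight function `w`. -/
def PerfCal (Γ : Measure (I01 × Bool)) : Prop :=
  ∀ w : I01 → ℝ, Measurable w → (∃ C : ℝ, ∀ t, |w t| ≤ C) → calErr Γ w = 0

/-- `ext(Γ)`: couplings `Π` of triples `(u,v,y)` whose `(v,y)`-marginal is `Γ` and whose
`(u,y)`-marginal is perfectly calibrated. -/
def extSet (Γ : Measure (I01 × Bool)) : Set (Measure (I01 × I01 × Bool)) :=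
  {π | IsProbabilityMeasure π ∧
    π.map (fun p => (p.2.1, p.2.2)) = Γ ∧
    PerfCal (π.map (fun p => (p.1, p.2.2)))}

/-- The lower distance to calibration `ldCE(Γ)`. -/
def ldCE (Γ : Measure (I01 × Bool)) : ℝ :=
  sInf {x | ∃ π ∈ extSet Γ, x = ∫ p, |(p.1 : ℝ) - (p.2.1 : ℝ)| ∂π}

/-- The upper distance to calibration `udCE(Γ)`: distance to calibration via post-processing. -/
def udCE (Γ : Measure (I01 × Bool)) : ℝ :=
  sInf {x | ∃ κ : I01 → I01, Measurable κ ∧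
    PerfCal (Γ.map (fun p => (κ p.1, p.2))) ∧
    x = ∫ p, |(p.1 : ℝ) - (κ p.1 : ℝ)| ∂Γ}

/-- The smooth calibration error `smCE(Γ)`: supremum of `E[(y−v)w(v)]` over `1`-Lipschitz
weight functions `w : [0,1] → [−1,1]`. -/
def smCE (Γ : Measure (I01 × Bool)) : ℝ :=
  sSup {x | ∃ w : I01 → ℝ, LipschitzWith 1 w ∧ (∀ t, |w t| ≤ 1) ∧ x = calErr Γ w}

/-- The prediction-label distribution `D_f` induced by a predictor `f`. -/
def predDist {𝒳 : Type*} [MeasurableSpace 𝒳] (D : Measure (𝒳 × Bool)) (f : 𝒳 → I01) :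
    Measure (I01 × Bool) :=
  D.map (fun p => (f p.1, p.2))

/-- `cal(D)`: the set of measurable predictors that are perfectly calibrated w.r.t. `D`. -/
def calSet {𝒳 : Type*} [MeasurableSpace 𝒳] (D : Measure (𝒳 × Bool)) : Set (𝒳 → I01) :=
  {g | Measurable g ∧ PerfCal (predDist D g)}

/-- The true (ℓ₁) distance to calibration `dCE_D(f)`. -/
def dCE {𝒳 : Type*} [MeasurableSpace 𝒳] (D : Measure (𝒳 × Bool)) (f : 𝒳 → I01) : ℝ :=
  sInf {x | ∃ g ∈ calSet D, x = ∫ p, |(f p.1 : ℝ) - (g p.1 : ℝ)| ∂D}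

/-- A finite partition of `[0,1]` into (order-convex) intervals. -/
structure IntervalPartition where
  m : ℕ
  piece : Fin m → Set ℝ
  ordConn : ∀ j, (piece j).OrdConnected
  disj : ∀ i j, i ≠ j → Disjoint (piece i) (piece j)
  cover : (⋃ j, piece j) = Set.Icc (0 : ℝ) 1

/-- `binnedECE(Γ, 𝓘) = Σ_j |E[(v − y)·1(v ∈ I_j)]|`. -/
def binnedECE (Γ : Measure (I01 × Bool)) (P : IntervalPartition) : ℝ :=
  ∑ j : Fin P.m,
    |∫ p, Set.indicator (P.piece j) (fun _ => ((p.1 : ℝ) - lbl p.2)) (p.1 : ℝ) ∂Γ|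

/-- The average interval width `w_Γ(𝓘) = Σ_j E[1(v ∈ I_j)]·w(I_j)`. -/
def avgWidth (Γ : Measure (I01 × Bool)) (P : IntervalPartition) : ℝ :=
  ∑ j : Fin P.m,
    (∫ p, Set.indicator (P.piece j) (fun _ => (1 : ℝ)) (p.1 : ℝ) ∂Γ) * Metric.diam (P.piece j)

/-- The interval calibration error `intCE(Γ)`. -/
def intCE (Γ : Measure (I01 × Bool)) : ℝ :=
  sInf {x | ∃ P : IntervalPartition, x = binnedECE Γ P + avgWidth Γ P}

/-- The random interval calibration error `RintCE(Γ, ε)`, with `r` uniform on `[0, ε)` and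
intervals `I^ε_{r,j} = [r + jε, r + (j+1)ε)`. -/
def RintCE (Γ : Measure (I01 × Bool)) (ε : ℝ) : ℝ :=
  (1 / ε) * ∫ r in Set.Ico (0 : ℝ) ε,
    ∑' j : ℤ, |∫ p, Set.indicator (Set.Ico (r + (j : ℝ) * ε) (r + ((j : ℝ) + 1) * ε))
      (fun _ => (lbl p.2 - (p.1 : ℝ))) (p.1 : ℝ) ∂Γ|

/-- The surrogate interval calibration error `SintCE(Γ)`. -/
def SintCE (Γ : Measure (I01 × Bool)) : ℝ :=
  ⨅ k : ℕ, (RintCE Γ ((1 / 2) ^ k) + (1 / 2) ^ k)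

/-- The squared Laplace-kernel calibration error:
`K_Lap(Γ) = E[(y−v)(y′−v′)·exp(−|v−v′|)]` over two independent samples from `Γ`. -/
def KLap (Γ : Measure (I01 × Bool)) : ℝ :=
  ∫ q, (lbl q.1.2 - (q.1.1 : ℝ)) * (lbl q.2.2 - (q.2.1 : ℝ)) *
    Real.exp (-|(q.1.1 : ℝ) - (q.2.1 : ℝ)|) ∂(Γ.prod Γ)

/-- The squared Gaussian-kernel calibration error:
`K_Gauss(Γ) = E[(y−v)(y′−v′)·exp(−(v−v′)²)]` over two independent samples from `Γ`. -/
def KGauss (Γ : Measure (I01 × Bool)) : ℝ :=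
  ∫ q, (lbl q.1.2 - (q.1.1 : ℝ)) * (lbl q.2.2 - (q.2.1 : ℝ)) *
    Real.exp (-(((q.1.1 : ℝ) - (q.2.1 : ℝ)) ^ 2)) ∂(Γ.prod Γ)


lemma aux_int {α : Type*} [MeasurableSpace α] (μ : Measure α) [IsFiniteMeasure μ] {g : α → ℝ}
    (hg : Measurable g) (C : ℝ) (h : ∀ a, |g a| ≤ C) : Integrable g μ :=
  Integrable.of_bound hg.aestronglyMeasurable C (Filter.Eventually.of_forall h)

lemma aux_lbl_meas : Measurable lbl := measurable_of_countable _

lemma aux_lbl_nonneg (y : Bool) : 0 ≤ lbl y := by unfold lbl; split_ifs <;> norm_num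
lemma aux_lbl_le (y : Bool) : lbl y ≤ 1 := by unfold lbl; split_ifs <;> norm_num

lemma aux_I (v : I01) : 0 ≤ (v : ℝ) ∧ (v : ℝ) ≤ 1 := v.2

lemma aux_partition (Γ : Measure (I01 × Bool)) [IsProbabilityMeasure Γ] (b : I01 → ℤ)
    (hb : Measurable b) (J : Finset ℤ) (hJ : ∀ v, b v ∈ J) (F : I01 × Bool → ℝ)
    (hF : Integrable F Γ) :
    ∫ p, F p ∂Γ = ∑ j ∈ J, ∫ p in {p | b p.1 = j}, F p ∂Γ := by
  rw [← integral_biUnion_finset]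
  · have : (⋃ j ∈ J, {p : I01 × Bool | b p.1 = j}) = Set.univ := by
      ext p; simp [hJ]
    rw [this, Measure.restrict_univ]
  · intro j _
    exact (hb.comp measurable_fst) (measurableSet_singleton j)
  · intro i _ j _ hij
    refine Set.disjoint_left.2 fun p h1 h2 => hij ?_
    exact h1.symm.trans h2
  · intro j _
    exact hF.integrableOn

lemma aux_key1 (Γ : Measure (I01 × Bool)) [IsProbabilityMeasure Γ] (b : I01 → ℤ)
    (hb : Measurable b) (J : Finset ℤ) (hJ : ∀ v, b v ∈ J) (ε : ℝ)
    (hε : ∀ v v' : I01, b v = b v' → |(v : ℝ) - v'| ≤ ε) :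
    ∃ σ : ℤ → ℝ, (∀ j, |σ j| ≤ 1) ∧
      udCE Γ ≤ ε + ∫ p, ((p.1 : ℝ) - lbl p.2) * σ (b p.1) ∂Γ := by
  classical
  let S : ℤ → Set (I01 × Bool) := fun j => {p | b p.1 = j}
  have hS : ∀ j, MeasurableSet (S j) := fun j =>
    (hb.comp measurable_fst) (measurableSet_singleton j)
  let m : ℤ → ℝ := fun j => Γ.real (S j)
  let Y : ℤ → ℝ := fun j => ∫ p in S j, lbl p.2 ∂Γ
  have hlblm : Measurable (fun p : I01 × Bool => lbl p.2) := aux_lbl_meas.comp measurable_snd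
  have hvm : Measurable (fun p : I01 × Bool => (p.1 : ℝ)) :=
    measurable_subtype_coe.comp measurable_fst
  have hlbli : Integrable (fun p : I01 × Bool => lbl p.2) Γ :=
    aux_int Γ hlblm 1 fun p => by
      rw [abs_of_nonneg (aux_lbl_nonneg _)]; exact aux_lbl_le _
  have hvi : Integrable (fun p : I01 × Bool => (p.1 : ℝ)) Γ :=
    aux_int Γ hvm 1 fun p => by
      rw [abs_of_nonneg (aux_I _).1]; exact (aux_I _).2
  have hm0 : ∀ j, 0 ≤ m j := fun j => measureReal_nonneg
  have hY0 : ∀ j, 0 ≤ Y j := fun j => integral_nonneg fun p => aux_lbl_nonneg _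
  have hYm : ∀ j, Y j ≤ m j := fun j => by
    have : Y j ≤ ∫ p in S j, (1:ℝ) ∂Γ :=
      integral_mono hlbli.integrableOn (integrable_const _) fun p => aux_lbl_le _
    simpa [m] using this
  let k : ℤ → I01 := fun j => ⟨Y j / m j, div_nonneg (hY0 j) (hm0 j),
    div_le_one_of_le₀ (hYm j) (hm0 j)⟩
  have hk : ∀ j, (k j : ℝ) * m j = Y j := fun j => by
    show Y j / m j * m j = Y j
    by_cases h : m j = 0
    · have := hYm j; have := hY0 j; rw [h] at *; simp; linarith
    · field_simp
  have hkm : Measurable (fun v => k (b v)) := (measurable_of_countable k).comp hb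
  have hκ : PerfCal (Γ.map (fun p => (k (b p.1), p.2))) := by
    rintro w hw ⟨C, hC⟩
    unfold calErr
    have hmeas : Measurable (fun q : I01 × Bool => (lbl q.2 - (q.1 : ℝ)) * w q.1) :=
      (hlblm.sub hvm).mul (hw.comp measurable_fst)
    have hmap : Measurable (fun p : I01 × Bool => (k (b p.1), p.2)) :=
      (hkm.comp measurable_fst).prodMk measurable_snd
    rw [integral_map hmap.aemeasurable hmeas.aestronglyMeasurable]
    refine (aux_partition Γ b hb J hJ _ (aux_int Γ (hmeas.comp hmap) C ?_)).trans ?_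
    swap
    · refine Finset.sum_eq_zero fun j _ => ?_
      rw [setIntegral_congr_fun (g := fun p => (lbl p.2 - (k j : ℝ)) * w (k j)) (hS j)]
      · rw [integral_mul_const, integral_sub hlbli.integrableOn (integrable_const _)]
        have := hk j
        simp only [integral_const, smul_eq_mul, measureReal_restrict_apply_univ]
        show (Y j - m j * k j) * _ = 0
        rw [← this]; ring
      · intro p hp
        have : b p.1 = j := hp
        simp only [Function.comp, this]
    · intro p
      simp only [Function.comp, abs_mul]
      have h1 : |lbl p.2 - (k (b p.1) : ℝ)| ≤ 1 := by
        have := aux_lbl_nonneg p.2; have := aux_lbl_le p.2; have := aux_I (k (b p.1))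
        rw [abs_le]; constructor <;> linarith
      calc _ ≤ 1 * C := mul_le_mul h1 (hC _) (abs_nonneg _) zero_le_one
        _ = C := one_mul C
  let E : ℤ → ℝ := fun j => ∫ p in S j, ((p.1 : ℝ) - lbl p.2) ∂Γ
  let σ : ℤ → ℝ := fun j => if 0 ≤ E j then 1 else -1
  have hσ : ∀ j, |σ j| ≤ 1 := fun j => by simp only [σ]; split_ifs <;> simp
  refine ⟨σ, hσ, ?_⟩
  have hσm : Measurable (fun v => σ (b v)) := (measurable_of_countable σ).comp hb
  have hle : udCE Γ ≤ ∫ p, |(p.1 : ℝ) - (k (b p.1) : ℝ)| ∂Γ := by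
    refine csInf_le ⟨0, ?_⟩ ⟨fun v => k (b v), hkm, hκ, rfl⟩
    rintro x ⟨κ, -, -, rfl⟩
    exact integral_nonneg fun p => abs_nonneg _
  refine hle.trans ?_
  have hi1 : Integrable (fun p : I01 × Bool => |(p.1 : ℝ) - (k (b p.1) : ℝ)|) Γ := by
    refine (hvi.sub (aux_int Γ (measurable_subtype_coe.comp (hkm.comp measurable_fst)) 1 ?_)).abs
    intro p
    show |(k (b p.1) : ℝ)| ≤ 1
    rw [abs_of_nonneg (aux_I _).1]; exact (aux_I _).2
  have hi2 : Integrable (fun p : I01 × Bool => ((p.1 : ℝ) - lbl p.2) * σ (b p.1)) Γ := by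
    refine aux_int Γ ((hvm.sub hlblm).mul (hσm.comp measurable_fst)) 1 ?_
    intro p
    rw [abs_mul]
    refine mul_le_one₀ ?_ (abs_nonneg _) (hσ _)
    have := aux_lbl_nonneg p.2; have := aux_lbl_le p.2; have := aux_I p.1
    rw [abs_le]; constructor <;> linarith
  have hεint : ε = ∫ p : I01 × Bool, ε ∂Γ := by simp
  rw [aux_partition Γ b hb J hJ _ hi1, aux_partition Γ b hb J hJ _ hi2, hεint,
    aux_partition Γ b hb J hJ _ (integrable_const ε), ← Finset.sum_add_distrib]
  refine Finset.sum_le_sum fun j _ => ?_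
  have e1 : ∫ p in S j, ((p.1 : ℝ) - lbl p.2) * σ (b p.1) ∂Γ = |E j| := by
    rw [setIntegral_congr_fun (g := fun p => ((p.1 : ℝ) - lbl p.2) * σ j) (hS j)]
    · rw [integral_mul_const]
      show E j * σ j = _
      simp only [σ]; split_ifs with h
      · rw [abs_of_nonneg h, mul_one]
      · rw [abs_of_neg (not_le.1 h)]; ring
    · intro p hp
      have : b p.1 = j := hp
      simp only [this]
  have e2 : ∫ p in S j, ε ∂Γ = m j * ε := by
    simp [m]
  have e3 : ∫ p in S j, |(p.1 : ℝ) - (k (b p.1) : ℝ)| ∂Γ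
      = ∫ p in S j, |(p.1 : ℝ) - (k j : ℝ)| ∂Γ := by
    refine setIntegral_congr_fun (hS j) fun p hp => ?_
    have : b p.1 = j := hp
    simp only [this]
  show ∫ p in S j, |(p.1 : ℝ) - (k (b p.1) : ℝ)| ∂Γ ≤ ∫ p in S j, ε ∂Γ +
    ∫ p in S j, ((p.1 : ℝ) - lbl p.2) * σ (b p.1) ∂Γ
  rw [e1, e2, e3]
  rcases (hm0 j).eq_or_lt with h0 | hpos
  · have : Γ.restrict (S j) = 0 := by
      rw [Measure.restrict_eq_zero]
      exact (measureReal_eq_zero_iff (by finiteness)).1 h0.symm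
    rw [this, ← h0]; simp
  · have hpt : ∀ p ∈ S j, |(p.1 : ℝ) - (k j : ℝ)| ≤ ε + |E j| / m j := by
      intro p hp
      have hEj : E j = (∫ q in S j, (q.1 : ℝ) ∂Γ) - Y j :=
        integral_sub hvi.integrableOn hlbli.integrableOn
      have hA : |∫ q in S j, ((p.1 : ℝ) - q.1) ∂Γ| ≤ ε * m j := by
        have := norm_setIntegral_le_of_norm_le_const (μ := Γ) (s := S j)
          (f := fun q => (p.1 : ℝ) - q.1) (C := ε) (by finiteness)
          (fun q hq => hε _ _ ((show b p.1 = j from hp).trans (show b q.1 = j from hq).symm))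
        simpa [m] using this
      have hA' : ∫ q in S j, ((p.1 : ℝ) - q.1) ∂Γ
          = m j * p.1 - ∫ q in S j, (q.1 : ℝ) ∂Γ := by
        rw [integral_sub (integrable_const _) hvi.integrableOn]
        simp [m]
      have hkj := hk j
      have : (p.1 : ℝ) - k j = ((∫ q in S j, ((p.1 : ℝ) - q.1) ∂Γ) + E j) / m j := by
        rw [hA', hEj, ← hkj]; field_simp; ring
      rw [this, abs_div, abs_of_pos hpos, div_le_iff₀ hpos, add_mul,
        div_mul_cancel₀ _ hpos.ne']
      exact (abs_add_le _ _).trans (by linarith)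
    have hb1 : ∫ p in S j, |(p.1 : ℝ) - (k j : ℝ)| ∂Γ
        ≤ ∫ p in S j, (ε + |E j| / m j) ∂Γ :=
      setIntegral_mono_on (hvi.sub (integrable_const _)).abs.integrableOn
        (integrable_const _) (hS j) hpt
    refine hb1.trans (le_of_eq ?_)
    simp only [integral_const, smul_eq_mul, measureReal_restrict_apply_univ]
    show m j * _ = _
    field_simp

lemma aux_floor_int (x : ℝ) : IntervalIntegrable (fun s : ℝ => ((⌊x + s⌋ : ℤ) : ℝ)) volume 0 1 := by
  refine Monotone.intervalIntegrable fun s t h => ?_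
  exact_mod_cast Int.floor_mono (by linarith)

lemma aux_floor_avg (x : ℝ) : ∫ s in (0:ℝ)..1, ((⌊x + s⌋ : ℤ) : ℝ)
    = x + 1/2 - ∫ s in (0:ℝ)..1, Int.fract s := by
  have h1 : ∫ s in (0:ℝ)..1, Int.fract (x + s) = ∫ s in (0:ℝ)..1, Int.fract s := by
    rw [intervalIntegral.integral_comp_add_left (fun s => Int.fract s)]
    have hp : Function.Periodic (fun s : ℝ => Int.fract s) 1 := fun s => by simp
    have := hp.intervalIntegral_add_eq x 0
    simpa using this
  have h2 : ∀ s : ℝ, ((⌊x + s⌋ : ℤ) : ℝ) = (x + s) - Int.fract (x + s) := fun s => by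
    have := Int.floor_add_fract (x + s); linarith
  have hi : IntervalIntegrable (fun s : ℝ => Int.fract (x + s)) volume 0 1 := by
    have : (fun s : ℝ => Int.fract (x + s)) = fun s => (x + s) - ((⌊x + s⌋ : ℤ) : ℝ) := by
      ext s; rw [h2]; ring
    rw [this]
    exact (Continuous.intervalIntegrable (by fun_prop) _ _).sub (aux_floor_int x)
  simp_rw [h2]
  rw [intervalIntegral.integral_sub (Continuous.intervalIntegrable (by fun_prop) _ _) hi, h1]
  rw [intervalIntegral.integral_add (by simp) (by simp)]
  simp

lemma aux_floor_abs (x y : ℝ) : ∫ s in (0:ℝ)..1, |((⌊x + s⌋ : ℤ) : ℝ) - ((⌊y + s⌋ : ℤ) : ℝ)|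
    = |x - y| := by
  wlog h : y ≤ x generalizing x y
  · rw [abs_sub_comm x y, ← this y x (not_le.1 h).le]
    simp_rw [abs_sub_comm]
  have : ∀ s : ℝ, |((⌊x + s⌋ : ℤ) : ℝ) - ((⌊y + s⌋ : ℤ) : ℝ)|
      = ((⌊x + s⌋ : ℤ) : ℝ) - ((⌊y + s⌋ : ℤ) : ℝ) := fun s => by
    refine abs_of_nonneg (sub_nonneg.2 ?_)
    exact_mod_cast Int.floor_mono (by linarith)
  simp_rw [this]
  rw [intervalIntegral.integral_sub (aux_floor_int x) (aux_floor_int y), aux_floor_avg,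
    aux_floor_avg, abs_of_nonneg (by linarith)]
  ring

lemma aux_choose {α : Type*} [MeasurableSpace α] (π : Measure α) [IsProbabilityMeasure π]
    (u v : α → ℝ) (hu : Measurable u) (hv : Measurable v) (C : ℝ) (hC : ∀ a, |u a - v a| ≤ C) :
    ∃ s ∈ Set.Ioc (0:ℝ) 1, ∫ a, |((⌊u a + s⌋ : ℤ) : ℝ) - ((⌊v a + s⌋ : ℤ) : ℝ)| ∂π
      ≤ ∫ a, |u a - v a| ∂π := by
  let μ : Measure ℝ := volume.restrict (Set.Ioc (0:ℝ) 1)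
  haveI : IsProbabilityMeasure μ := ⟨by simp [μ]⟩
  let F : α → ℝ → ℝ := fun a s => |((⌊u a + s⌋ : ℤ) : ℝ) - ((⌊v a + s⌋ : ℤ) : ℝ)|
  have hFm : Measurable (Function.uncurry F) := by
    have h1 : Measurable fun p : α × ℝ => ((⌊u p.1 + p.2⌋ : ℤ) : ℝ) :=
      (measurable_of_countable (fun z : ℤ => (z : ℝ))).comp
        (Int.measurable_floor.comp ((hu.comp measurable_fst).add measurable_snd))
    have h2 : Measurable fun p : α × ℝ => ((⌊v p.1 + p.2⌋ : ℤ) : ℝ) :=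
      (measurable_of_countable (fun z : ℤ => (z : ℝ))).comp
        (Int.measurable_floor.comp ((hv.comp measurable_fst).add measurable_snd))
    exact (h1.sub h2).abs
  have hFi : Integrable (Function.uncurry F) (π.prod μ) := by
    refine aux_int _ hFm (C + 1) ?_
    rintro ⟨a, s⟩
    simp only [Function.uncurry, F, abs_abs]
    have := abs_le.1 (hC a)
    have := Int.floor_le (u a + s); have := Int.lt_floor_add_one (u a + s)
    have := Int.floor_le (v a + s); have := Int.lt_floor_add_one (v a + s)
    rw [abs_le]; constructor <;> linarith
  have hsw := integral_integral_swap hFi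
  have hin : ∀ a, ∫ s, F a s ∂μ = |u a - v a| := fun a => by
    rw [← aux_floor_abs, intervalIntegral.integral_of_le zero_le_one]
  simp_rw [hin] at hsw
  have hae : μ (Set.Ioc (0:ℝ) 1)ᶜ = 0 := by
    simp [μ]
  obtain ⟨s, hs, hs'⟩ := exists_notMem_null_le_integral (μ := μ)
    (f := fun s => ∫ a, F a s ∂π) hFi.integral_prod_right hae
  exact ⟨s, by simpa using hs, by rw [hsw]; exact hs'⟩

lemma aux_key2 (Γ : Measure (I01 × Bool)) (π : Measure (I01 × I01 × Bool)) (hπ : π ∈ extSet Γ)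
    (c : ℝ) (hc : 0 < c) :
    udCE Γ ≤ 1 / c + (∫ p, |(p.1 : ℝ) - (p.2.1 : ℝ)| ∂π)
      + 2 * (c * ∫ p, |(p.1 : ℝ) - (p.2.1 : ℝ)| ∂π) := by
  obtain ⟨hP, hΓ, hcal⟩ := hπ
  have mu : Measurable fun p : I01 × I01 × Bool => (p.1 : ℝ) :=
    measurable_subtype_coe.comp measurable_fst
  have mv : Measurable fun p : I01 × I01 × Bool => (p.2.1 : ℝ) :=
    measurable_subtype_coe.comp (measurable_fst.comp measurable_snd)
  have my : Measurable fun p : I01 × I01 × Bool => lbl p.2.2 :=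
    aux_lbl_meas.comp (measurable_snd.comp measurable_snd)
  have mmap : Measurable fun p : I01 × I01 × Bool => (p.2.1, p.2.2) :=
    (measurable_fst.comp measurable_snd).prodMk (measurable_snd.comp measurable_snd)
  have mmap' : Measurable fun p : I01 × I01 × Bool => (p.1, p.2.2) :=
    measurable_fst.prodMk (measurable_snd.comp measurable_snd)
  haveI : IsProbabilityMeasure Γ := by
    rw [← hΓ]; exact Measure.isProbabilityMeasure_map mmap.aemeasurable
  obtain ⟨s, hs, hs'⟩ := aux_choose π (fun p => c * (p.1 : ℝ)) (fun p => c * (p.2.1 : ℝ))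
    (mu.const_mul c) (mv.const_mul c) c (by
      intro p
      have := aux_I p.1; have := aux_I p.2.1
      rw [← mul_sub, abs_mul, abs_of_pos hc]
      refine mul_le_of_le_one_right hc.le ?_
      rw [abs_le]; constructor <;> linarith)
  have hd : ∫ p : I01 × I01 × Bool, |c * (p.1 : ℝ) - c * (p.2.1 : ℝ)| ∂π
      = c * ∫ p, |(p.1 : ℝ) - (p.2.1 : ℝ)| ∂π := by
    rw [← integral_const_mul]
    refine integral_congr_ae (Filter.Eventually.of_forall fun p => ?_)
    simp only [← mul_sub, abs_mul, abs_of_pos hc]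
  rw [hd] at hs'
  let b : I01 → ℤ := fun v => ⌊c * (v : ℝ) + s⌋
  have hb : Measurable b :=
    Int.measurable_floor.comp ((measurable_subtype_coe.const_mul c).add_const s)
  have hJ : ∀ v, b v ∈ Finset.Icc (0:ℤ) ⌊c + 1⌋ := by
    intro v
    have h := aux_I v
    rw [Finset.mem_Icc]
    constructor
    · exact Int.floor_nonneg.2 (add_nonneg (mul_nonneg hc.le h.1) hs.1.le)
    · exact Int.floor_mono (add_le_add (mul_le_of_le_one_right hc.le h.2) hs.2)
  obtain ⟨σ, hσ, hud⟩ := aux_key1 Γ b hb _ hJ (1 / c) (by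
    intro v v' h
    have h1 := Int.abs_sub_lt_one_of_floor_eq_floor h
    have : c * (v:ℝ) + s - (c * v' + s) = c * ((v:ℝ) - v') := by ring
    rw [this, abs_mul, abs_of_pos hc] at h1
    rw [le_div_iff₀ hc]; linarith)
  refine hud.trans ?_
  have hσm : Measurable (fun v => σ (b v)) := (measurable_of_countable σ).comp hb
  have hmF : Measurable (fun p : I01 × Bool => ((p.1 : ℝ) - lbl p.2) * σ (b p.1)) :=
    ((measurable_subtype_coe.comp measurable_fst).sub (aux_lbl_meas.comp measurable_snd)).mul
      (hσm.comp measurable_fst)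
  have hmG : Measurable (fun p : I01 × Bool => (lbl p.2 - (p.1 : ℝ)) * σ (b p.1)) :=
    ((aux_lbl_meas.comp measurable_snd).sub (measurable_subtype_coe.comp measurable_fst)).mul
      (hσm.comp measurable_fst)
  have e1 : ∫ p, ((p.1 : ℝ) - lbl p.2) * σ (b p.1) ∂Γ
      = ∫ p, ((p.2.1 : ℝ) - lbl p.2.2) * σ (b p.2.1) ∂π := by
    rw [← hΓ, integral_map mmap.aemeasurable hmF.aestronglyMeasurable]
  have e2 : ∫ p, (lbl p.2.2 - (p.1 : ℝ)) * σ (b p.1) ∂π = 0 := by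
    have := hcal (fun v => σ (b v)) hσm ⟨1, fun t => hσ _⟩
    unfold calErr at this
    rwa [integral_map mmap'.aemeasurable hmG.aestronglyMeasurable] at this
  have bd : ∀ (x : I01) (y : Bool) (j : ℤ), |((x:ℝ) - lbl y) * σ j| ≤ 1 := by
    intro x y j
    rw [abs_mul]
    refine mul_le_one₀ ?_ (abs_nonneg _) (hσ _)
    have := aux_lbl_nonneg y; have := aux_lbl_le y; have := aux_I x
    rw [abs_le]; constructor <;> linarith
  have i1 : Integrable (fun p : I01 × I01 × Bool =>
      ((p.2.1 : ℝ) - lbl p.2.2) * σ (b p.2.1)) π :=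
    aux_int π (hmF.comp mmap) 1 fun p => bd _ _ _
  have i2 : Integrable (fun p : I01 × I01 × Bool =>
      (lbl p.2.2 - (p.1 : ℝ)) * σ (b p.1)) π :=
    aux_int π (hmG.comp mmap') 1 fun p => by
      have := bd p.1 p.2.2 (b p.1)
      rwa [abs_mul, abs_sub_comm, ← abs_mul] at this
  have i3 : Integrable (fun p : I01 × I01 × Bool => |(p.1 : ℝ) - (p.2.1 : ℝ)|) π :=
    aux_int π (mu.sub mv).abs 1 fun p => by
      have := aux_I p.1; have := aux_I p.2.1
      rw [abs_abs, abs_le]; constructor <;> linarith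
  have mb : Measurable fun v => ((b v : ℤ) : ℝ) :=
    (measurable_of_countable (fun z : ℤ => (z : ℝ))).comp hb
  have bb : ∀ v, 0 ≤ (b v : ℝ) ∧ (b v : ℝ) ≤ ⌊c + 1⌋ := fun v => by
    have := Finset.mem_Icc.1 (hJ v)
    exact ⟨by exact_mod_cast this.1, by exact_mod_cast this.2⟩
  have i4 : Integrable (fun p : I01 × I01 × Bool => |(b p.1 : ℝ) - (b p.2.1 : ℝ)|) π :=
    aux_int π ((mb.comp measurable_fst).sub
      (mb.comp (measurable_fst.comp measurable_snd))).abs (⌊c + 1⌋ : ℝ) fun p => by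
      have := bb p.1; have := bb p.2.1
      show |(|(b p.1 : ℝ) - (b p.2.1 : ℝ)|)| ≤ _
      rw [abs_abs, abs_le]; constructor <;> linarith
  have main : ∫ p, ((p.2.1 : ℝ) - lbl p.2.2) * σ (b p.2.1) ∂π
      ≤ (∫ p, |(p.1 : ℝ) - (p.2.1 : ℝ)| ∂π)
        + 2 * ∫ p, |(b p.1 : ℝ) - (b p.2.1 : ℝ)| ∂π := by
    have : ∫ p, (((p.2.1 : ℝ) - lbl p.2.2) * σ (b p.2.1)
        + (lbl p.2.2 - (p.1 : ℝ)) * σ (b p.1)) ∂π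
      ≤ ∫ p, (|(p.1 : ℝ) - (p.2.1 : ℝ)| + 2 * |(b p.1 : ℝ) - (b p.2.1 : ℝ)|) ∂π := by
      refine integral_mono (i1.add i2) (i3.add (i4.const_mul 2)) fun p => ?_
      show ((p.2.1 : ℝ) - lbl p.2.2) * σ (b p.2.1) + (lbl p.2.2 - (p.1 : ℝ)) * σ (b p.1)
        ≤ |(p.1 : ℝ) - (p.2.1 : ℝ)| + 2 * |(b p.1 : ℝ) - (b p.2.1 : ℝ)|
      by_cases h : b p.1 = b p.2.1
      · rw [h]
        have h1 : ((p.2.1 : ℝ) - lbl p.2.2) * σ (b p.2.1)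
          + (lbl p.2.2 - (p.1 : ℝ)) * σ (b p.2.1) = ((p.2.1 : ℝ) - p.1) * σ (b p.2.1) := by ring
        rw [h1, sub_self, abs_zero, mul_zero, add_zero, abs_sub_comm]
        refine (le_abs_self _).trans ?_
        rw [abs_mul]
        exact mul_le_of_le_one_right (abs_nonneg _) (hσ _)
      · have h1 : (1:ℝ) ≤ |(b p.1 : ℝ) - (b p.2.1 : ℝ)| := by
          exact_mod_cast Int.one_le_abs (sub_ne_zero.2 h)
        have h2 := (abs_le.1 (bd p.2.1 p.2.2 (b p.2.1))).2
        have h3 := (abs_le.1 (bd p.1 p.2.2 (b p.1))).1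
        have h4 := abs_nonneg ((p.1 : ℝ) - (p.2.1 : ℝ))
        linarith
    rw [integral_add i1 i2, e2, integral_add i3 (i4.const_mul 2), integral_const_mul] at this
    linarith
  have hs'' : ∫ p, |(b p.1 : ℝ) - (b p.2.1 : ℝ)| ∂π ≤ c * ∫ p, |(p.1 : ℝ) - (p.2.1 : ℝ)| ∂π := hs'
  rw [e1]
  linarith

lemma aux_key3 (Γ : Measure (I01 × Bool)) (π : Measure (I01 × I01 × Bool)) (hπ : π ∈ extSet Γ) :
    udCE Γ ≤ 4 * Real.sqrt (∫ p, |(p.1 : ℝ) - (p.2.1 : ℝ)| ∂π) := by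
  have key := aux_key2 Γ π hπ
  obtain ⟨hP, -, -⟩ := hπ
  set d := ∫ p, |(p.1 : ℝ) - (p.2.1 : ℝ)| ∂π with hd
  have hd0 : 0 ≤ d := integral_nonneg fun p => abs_nonneg _
  have hd1 : d ≤ 1 := by
    have : ‖d‖ ≤ 1 * π.real Set.univ := norm_integral_le_of_norm_le_const
      (Filter.Eventually.of_forall fun p => by
        have := aux_I p.1; have := aux_I p.2.1
        rw [Real.norm_eq_abs, abs_abs, abs_le]; constructor <;> linarith)
    simpa [abs_of_nonneg hd0] using this
  rcases hd0.eq_or_lt with h | h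
  · rw [← h] at key ⊢
    simp only [Real.sqrt_zero, mul_zero, add_zero] at *
    refine le_of_forall_pos_le_add fun ε hε => ?_
    have := key (1 / ε) (by positivity)
    rw [one_div_one_div] at this
    linarith
  · have hs : 0 < Real.sqrt d := Real.sqrt_pos.2 h
    have hk := key (1 / Real.sqrt d) (by positivity)
    have hsq : Real.sqrt d * Real.sqrt d = d := Real.mul_self_sqrt hd0
    have hs1 : Real.sqrt d ≤ 1 := Real.sqrt_le_one.2 hd1
    rw [one_div_one_div] at hk
    have : 1 / Real.sqrt d * d = Real.sqrt d := by
      rw [one_div, inv_mul_eq_div, div_eq_iff hs.ne', hsq]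
    rw [this] at hk
    nlinarith

/-- `ldCE_D(f) ≤ dCE_D(f) ≤ 4·√(ldCE_D(f))` and
`(1/16)·udCE_D(f)² ≤ dCE_D(f) ≤ udCE_D(f)`. -/
theorem ldCE_udCE_quadratic_bounds {𝒳 : Type*} [MeasurableSpace 𝒳]
    (D : Measure (𝒳 × Bool)) [IsProbabilityMeasure D] (f : 𝒳 → I01) (hf : Measurable f) :
    (ldCE (predDist D f) ≤ dCE D f ∧ dCE D f ≤ 4 * Real.sqrt (ldCE (predDist D f))) ∧
    ((1 / 16 : ℝ) * udCE (predDist D f) ^ 2 ≤ dCE D f ∧ dCE D f ≤ udCE (predDist D f)) := by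
  have mf : Measurable (fun p : 𝒳 × Bool => (f p.1, p.2)) :=
    (hf.comp measurable_fst).prodMk measurable_snd
  haveI hΓP : IsProbabilityMeasure (predDist D f) :=
    Measure.isProbabilityMeasure_map mf.aemeasurable
  -- every post-processing gives a calibrated predictor
  have hud_mem : ∀ x, (∃ κ : I01 → I01, Measurable κ ∧
      PerfCal ((predDist D f).map (fun p => (κ p.1, p.2))) ∧
      x = ∫ p, |(p.1 : ℝ) - (κ p.1 : ℝ)| ∂(predDist D f)) →
      ∃ g ∈ calSet D, x = ∫ p, |(f p.1 : ℝ) - (g p.1 : ℝ)| ∂D := by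
    rintro x ⟨κ, hκ, hcal, rfl⟩
    refine ⟨fun x => κ (f x), ⟨hκ.comp hf, ?_⟩, ?_⟩
    · unfold predDist at hcal ⊢
      have m1 : Measurable (fun p : I01 × Bool => (κ p.1, p.2)) :=
        (hκ.comp measurable_fst).prodMk measurable_snd
      rwa [Measure.map_map m1 mf] at hcal
    · unfold predDist
      rw [integral_map mf.aemeasurable]
      exact ((measurable_subtype_coe.comp measurable_fst).sub
        (measurable_subtype_coe.comp (hκ.comp measurable_fst))).abs.aestronglyMeasurable
  have hd_mem : ∀ x, (∃ g ∈ calSet D, x = ∫ p, |(f p.1 : ℝ) - (g p.1 : ℝ)| ∂D) →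
      ∃ π ∈ extSet (predDist D f), x = ∫ p, |(p.1 : ℝ) - (p.2.1 : ℝ)| ∂π := by
    rintro x ⟨g, ⟨hg, hcal⟩, rfl⟩
    have mt : Measurable (fun p : 𝒳 × Bool => (g p.1, f p.1, p.2)) :=
      (hg.comp measurable_fst).prodMk mf
    refine ⟨D.map (fun p => (g p.1, f p.1, p.2)),
      ⟨Measure.isProbabilityMeasure_map mt.aemeasurable, ?_, ?_⟩, ?_⟩
    · have m1 : Measurable (fun p : I01 × I01 × Bool => (p.2.1, p.2.2)) :=
        (measurable_fst.comp measurable_snd).prodMk (measurable_snd.comp measurable_snd)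
      rw [Measure.map_map m1 mt]
      rfl
    · have m1 : Measurable (fun p : I01 × I01 × Bool => (p.1, p.2.2)) :=
        measurable_fst.prodMk (measurable_snd.comp measurable_snd)
      rw [Measure.map_map m1 mt]
      exact hcal
    · rw [integral_map mt.aemeasurable]
      · simp_rw [abs_sub_comm]
      · exact ((measurable_subtype_coe.comp measurable_fst).sub
          (measurable_subtype_coe.comp (measurable_fst.comp
            measurable_snd))).abs.aestronglyMeasurable
  -- nonemptiness: the constant predictor
  have hne : ∃ x, ∃ κ : I01 → I01, Measurable κ ∧
      PerfCal ((predDist D f).map (fun p => (κ p.1, p.2))) ∧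
      x = ∫ p, |(p.1 : ℝ) - (κ p.1 : ℝ)| ∂(predDist D f) := by
    have hl : Measurable (fun p : I01 × Bool => lbl p.2) := aux_lbl_meas.comp measurable_snd
    have hli : Integrable (fun p : I01 × Bool => lbl p.2) (predDist D f) :=
      aux_int _ hl 1 fun p => by
        rw [abs_of_nonneg (aux_lbl_nonneg _)]; exact aux_lbl_le _
    let a : I01 := ⟨∫ p, lbl p.2 ∂(predDist D f), integral_nonneg fun p => aux_lbl_nonneg _, by
      have := integral_mono hli (integrable_const (1:ℝ)) (fun p => aux_lbl_le p.2)
      simpa using this⟩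
    refine ⟨_, fun _ => a, measurable_const, ?_, rfl⟩
    rintro w hw -
    unfold calErr
    rw [integral_map (measurable_const.prodMk measurable_snd).aemeasurable]
    · show ∫ x : I01 × Bool, (lbl x.2 - (a : ℝ)) * w a ∂predDist D f = 0
      rw [integral_mul_const, integral_sub hli (integrable_const _)]
      simp [a]
    · exact ((hl.sub (measurable_subtype_coe.comp measurable_fst)).mul
        (hw.comp measurable_fst)).aestronglyMeasurable
  obtain ⟨x0, hx0⟩ := hne
  have hbd_d : BddBelow {x | ∃ g ∈ calSet D, x = ∫ p, |(f p.1 : ℝ) - (g p.1 : ℝ)| ∂D} := by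
    refine ⟨0, ?_⟩
    rintro x ⟨g, -, rfl⟩
    exact integral_nonneg fun p => abs_nonneg _
  have hbd_l : BddBelow {x | ∃ π ∈ extSet (predDist D f),
      x = ∫ p, |(p.1 : ℝ) - (p.2.1 : ℝ)| ∂π} := by
    refine ⟨0, ?_⟩
    rintro x ⟨g, -, rfl⟩
    exact integral_nonneg fun p => abs_nonneg _
  have h1 : ldCE (predDist D f) ≤ dCE D f :=
    csInf_le_csInf hbd_l ⟨x0, hud_mem _ hx0⟩ hd_mem
  have h2 : dCE D f ≤ udCE (predDist D f) :=
    csInf_le_csInf hbd_d ⟨x0, hx0⟩ hud_mem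
  have hu0 : 0 ≤ udCE (predDist D f) := by
    refine Real.sInf_nonneg ?_
    rintro x ⟨g, -, -, rfl⟩
    exact integral_nonneg fun p => abs_nonneg _
  have h3 : (1 / 16 : ℝ) * udCE (predDist D f) ^ 2 ≤ ldCE (predDist D f) := by
    refine le_csInf ⟨x0, hd_mem _ (hud_mem _ hx0)⟩ ?_
    rintro x ⟨π, hπ, rfl⟩
    have hk := aux_key3 _ π hπ
    have hd0 : 0 ≤ ∫ p, |(p.1 : ℝ) - (p.2.1 : ℝ)| ∂π := integral_nonneg fun p => abs_nonneg _
    have := pow_le_pow_left₀ hu0 hk 2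
    rw [mul_pow, Real.sq_sqrt hd0] at this
    linarith
  refine ⟨⟨h1, h2.trans ?_⟩, h3.trans h1, h2⟩
  have h4 : udCE (predDist D f) / 4 ≤ Real.sqrt (ldCE (predDist D f)) :=
    Real.le_sqrt_of_sq_le (by linarith [h3, (by ring : (udCE (predDist D f) / 4) ^ 2
      = (1 / 16 : ℝ) * udCE (predDist D f) ^ 2)])
  linarith
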